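/- Let n ≥ 3 and let 𝒢 = {G_1, …, G_n} be a family of n graphs (not necessarily distinct) on a common vertex set V with |V| = n, with σ(𝒢) ≥ n. Let C_n = x_1 x_2 ⋯ x_n x_1 be a rainbow Hamiltonian cycle with x_i x_{i+1} ∈ E(G_i) for each i ∈ [n] (indices modulo n). If there is no rainbow cycle of length n − 1 in 𝒢 containing x_1, then x_i x_{i+2} ∉ E(G_j) for all i ∈ [n] and all j ∈ [n] (indices modulo n). -/

import Mathlib

/-- `c`, `φ` encode a rainbow cycle of length `ℓ` in the graph family `G`:
`c` lists the vertices of the cycle in cyclic order (injectively), and `φ`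
injectively assigns to the edge `c i — c (i+1)` a member of the family
containing it. -/
def IsRainbowCycle {V ι : Type*} {ℓ : ℕ} (G : ι → SimpleGraph V)
    (c : ZMod ℓ → V) (φ : ZMod ℓ → ι) : Prop :=
  Function.Injective c ∧ Function.Injective φ ∧
    ∀ i : ZMod ℓ, (G (φ i)).Adj (c i) (c (i + 1))

/-- The family `G` contains a rainbow cycle of length `ℓ`. -/
def HasRainbowCycle {V ι : Type*} (G : ι → SimpleGraph V) (ℓ : ℕ) : Prop :=
  ∃ (c : ZMod ℓ → V) (φ : ZMod ℓ → ι), IsRainbowCycle G c φ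

/-- The family `G` contains a rainbow cycle of length `ℓ` passing through `x`. -/
def HasRainbowCycleThrough {V ι : Type*} (G : ι → SimpleGraph V) (ℓ : ℕ) (x : V) : Prop :=
  ∃ (c : ZMod ℓ → V) (φ : ZMod ℓ → ι), IsRainbowCycle G c φ ∧ ∃ i, c i = x

theorem mkCycle {V ι : Type*} (G : ι → SimpleGraph V) (m : ℕ) (hm : 2 ≤ m)
    (y : ℕ → V) (φ : ℕ → ι) (x : V)
    (hy : ∀ a b, a < m → b < m → y a = y b → a = b)
    (hφ : ∀ a b, a < m → b < m → φ a = φ b → a = b)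
    (hadj : ∀ t, t + 1 < m → (G (φ t)).Adj (y t) (y (t + 1)))
    (hlast : (G (φ (m - 1))).Adj (y (m - 1)) (y 0))
    (hx : ∃ s, s < m ∧ y s = x) : HasRainbowCycleThrough G m x := by
  have : NeZero m := ⟨by omega⟩
  have : Fact (1 < m) := ⟨by omega⟩
  refine ⟨fun i => y i.val, fun i => φ i.val, ⟨?_, ?_, ?_⟩, ?_⟩
  · intro a b h
    exact ZMod.val_injective m (hy _ _ (ZMod.val_lt a) (ZMod.val_lt b) h)
  · intro a b h
    exact ZMod.val_injective m (hφ _ _ (ZMod.val_lt a) (ZMod.val_lt b) h)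
  · intro i
    have hi := ZMod.val_lt i
    have h1 : (1 : ZMod m).val = 1 := ZMod.val_one m
    have h2 := ZMod.val_add i 1
    rw [h1] at h2
    by_cases h : i.val + 1 < m
    · rw [Nat.mod_eq_of_lt h] at h2
      simpa [h2] using hadj _ h
    · have h3 : i.val + 1 = m := by omega
      rw [h3, Nat.mod_self] at h2
      have h4 : i.val = m - 1 := by omega
      simpa [h2, h4] using hlast
  · obtain ⟨s, hs, rfl⟩ := hx
    exact ⟨(s : ZMod m), by simp [ZMod.val_natCast, Nat.mod_eq_of_lt hs]⟩

theorem rotCycle {V ι : Type*} (G : ι → SimpleGraph V) (m : ℕ) (hm : 2 ≤ m)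
    (y : ℕ → V) (ψ : ℕ → ι) (x : V) (p q : ι) (hpq : p ≠ q)
    (hy : ∀ a b, a < m → b < m → y a = y b → a = b)
    (hψ : ∀ a b, a < m - 1 → b < m - 1 → ψ a = ψ b → a = b)
    (hp : ∀ a, a < m - 1 → ψ a ≠ p) (hq : ∀ a, a < m - 1 → ψ a ≠ q)
    (hadj : ∀ t, t + 1 < m → (G (ψ t)).Adj (y t) (y (t + 1)))
    (hx : ∃ s, s < m ∧ y s = x)
    (t : ℕ) (ht : t < m - 1) (h1 : (G p).Adj (y 0) (y (t + 1)))
    (h2 : (G q).Adj (y t) (y (m - 1))) : HasRainbowCycleThrough G m x := by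
  refine mkCycle G m hm (fun s => if s ≤ t then y s else y (m + t - s))
    (fun s => if s < t then ψ s else if s = t then q else if s < m - 1 then ψ (m + t - s - 1)
      else p) x ?_ ?_ ?_ ?_ ?_
  · intro a b ha hb h
    split_ifs at h
    · exact hy _ _ ha hb h
    · have := hy _ _ ha (by omega) h; omega
    · have := hy _ _ (by omega) hb h; omega
    · have := hy _ _ (by omega) (by omega) h; omega
  · intro a b ha hb h
    split_ifs at h <;>
    first
    | omega
    | exact absurd h (hp _ (by omega))
    | exact absurd h (hq _ (by omega))
    | exact absurd h.symm (hp _ (by omega))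
    | exact absurd h.symm (hq _ (by omega))
    | exact absurd h hpq
    | exact absurd h.symm hpq
    | (have := hψ _ _ (by omega) (by omega) h; omega)
  · intro s hs
    rcases lt_trichotomy s t with h | h | h
    · rw [if_pos h, if_pos (by omega), if_pos (by omega)]
      exact hadj s hs
    · subst h
      rw [if_neg (by omega), if_pos rfl, if_pos le_rfl, if_neg (by omega)]
      rw [show m + s - (s + 1) = m - 1 by omega]
      exact h2
    · rw [if_neg (by omega), if_neg (by omega), if_pos (by omega), if_neg (by omega),
        if_neg (by omega)]
      have := hadj (m + t - s - 1) (by omega)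
      rw [show m + t - s - 1 + 1 = m + t - s by omega] at this
      rw [show m + t - (s + 1) = m + t - s - 1 by omega]
      exact this.symm
  · skip
    rw [if_neg (by omega), if_neg (by omega), if_neg (by omega), if_neg (by omega),
      if_pos (by omega), show m + t - (m - 1) = t + 1 by omega]
    exact h1.symm
  · obtain ⟨s, hs, rfl⟩ := hx
    by_cases h : s ≤ t
    · exact ⟨s, hs, by simp [h]⟩
    · refine ⟨m + t - s, by omega, ?_⟩
      rw [if_neg (by omega), show m + t - (m + t - s) = s by omega]

theorem closeCycle {V ι : Type*} (G : ι → SimpleGraph V) (m : ℕ) (hm : 2 ≤ m)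
    (y : ℕ → V) (ψ : ℕ → ι) (x : V) (p : ι)
    (hy : ∀ a b, a < m → b < m → y a = y b → a = b)
    (hψ : ∀ a b, a < m - 1 → b < m - 1 → ψ a = ψ b → a = b)
    (hp : ∀ a, a < m - 1 → ψ a ≠ p)
    (hadj : ∀ t, t + 1 < m → (G (ψ t)).Adj (y t) (y (t + 1)))
    (hx : ∃ s, s < m ∧ y s = x)
    (h1 : (G p).Adj (y 0) (y (m - 1))) : HasRainbowCycleThrough G m x := by
  refine mkCycle G m hm y (fun s => if s < m - 1 then ψ s else p) x hy ?_ ?_ ?_ hx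
  · intro a b ha hb h
    split_ifs at h
    · exact hψ _ _ (by omega) (by omega) h
    · exact absurd h (hp _ (by omega))
    · exact absurd h.symm (hp _ (by omega))
    · omega
  · intro t ht
    rw [if_pos (by omega)]
    exact hadj t ht
  · skip
    rw [if_neg (by omega)]
    exact h1.symm

theorem pathLemma {V ι : Type*} [Fintype V] (G : ι → SimpleGraph V)
    [∀ i, DecidableRel (G i).Adj] (m : ℕ) (hm : 2 ≤ m)
    (hσ : ∀ u v : V, u ≠ v → (∃ i, ¬ (G i).Adj u v) →
      ∀ p q, m + 1 ≤ (G p).degree u + (G q).degree v)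
    (y : ℕ → V) (ψ : ℕ → ι) (x w : V) (p q : ι) (hpq : p ≠ q)
    (hy : ∀ a b, a < m → b < m → y a = y b → a = b)
    (hw : ∀ v, v = w ∨ ∃ s, s < m ∧ y s = v)
    (hψ : ∀ a b, a < m - 1 → b < m - 1 → ψ a = ψ b → a = b)
    (hp : ∀ a, a < m - 1 → ψ a ≠ p) (hq : ∀ a, a < m - 1 → ψ a ≠ q)
    (hadj : ∀ t, t + 1 < m → (G (ψ t)).Adj (y t) (y (t + 1)))
    (hx : ∃ s, s < m ∧ y s = x)
    (hno : ¬ HasRainbowCycleThrough G m x) :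
    ¬ (G p).Adj (y 0) (y (m - 1)) ∧ (G p).Adj (y 0) w ∧ (G q).Adj (y (m - 1)) w ∧
    (∀ t, t < m - 1 → (G p).Adj (y 0) (y (t + 1)) ∨ (G q).Adj (y t) (y (m - 1))) ∧
    (∀ t, t < m - 1 → (G p).Adj (y 0) (y (t + 1)) → (G q).Adj (y t) (y (m - 1)) → False) := by
  classical
  have hn1 : ¬ (G p).Adj (y 0) (y (m - 1)) := fun h =>
    hno (closeCycle G m hm y ψ x p hy hψ hp hadj hx h)
  have hn2 : ∀ t, t < m - 1 → (G p).Adj (y 0) (y (t + 1)) → (G q).Adj (y t) (y (m - 1)) → False :=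
    fun t ht h1 h2 => hno (rotCycle G m hm y ψ x p q hpq hy hψ hp hq hadj hx t ht h1 h2)
  have hdeg := hσ (y 0) (y (m - 1)) (fun h => by
    have := hy _ _ (by omega) (by omega) h; omega) ⟨p, hn1⟩ p q
  set A := (Finset.range (m - 1)).filter (fun t => (G p).Adj (y 0) (y (t + 1))) with hA
  set B := (Finset.range (m - 1)).filter (fun t => (G q).Adj (y t) (y (m - 1))) with hB
  set Wp : Finset V := if (G p).Adj (y 0) w then {w} else ∅ with hWp
  set Wq : Finset V := if (G q).Adj (y (m - 1)) w then {w} else ∅ with hWq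
  have h1 : (G p).degree (y 0) ≤ Wp.card + A.card := by
    have hsub : (G p).neighborFinset (y 0) ⊆ Wp ∪ A.image (fun t => y (t + 1)) := by
      intro v hv
      rw [SimpleGraph.mem_neighborFinset] at hv
      rw [Finset.mem_union]
      rcases hw v with rfl | ⟨s, hs, rfl⟩
      · left; simp [hWp, hv]
      · right
        rw [Finset.mem_image]
        have hs0 : s ≠ 0 := by rintro rfl; exact (G p).loopless.irrefl _ hv
        refine ⟨s - 1, ?_, by rw [show s - 1 + 1 = s by omega]⟩
        simp only [hA, Finset.mem_filter, Finset.mem_range]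
        rw [show s - 1 + 1 = s by omega]
        exact ⟨by omega, hv⟩
    calc (G p).degree (y 0) = ((G p).neighborFinset (y 0)).card := rfl
      _ ≤ _ := Finset.card_le_card hsub
      _ ≤ _ := Finset.card_union_le _ _
      _ ≤ _ := by gcongr; exact Finset.card_image_le
  have h2 : (G q).degree (y (m - 1)) ≤ Wq.card + B.card := by
    have hsub : (G q).neighborFinset (y (m - 1)) ⊆ Wq ∪ B.image y := by
      intro v hv
      rw [SimpleGraph.mem_neighborFinset] at hv
      rw [Finset.mem_union]
      rcases hw v with rfl | ⟨s, hs, rfl⟩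
      · left; simp [hWq, hv]
      · right
        rw [Finset.mem_image]
        have hs0 : s ≠ m - 1 := by rintro rfl; exact (G q).loopless.irrefl _ hv
        refine ⟨s, ?_, rfl⟩
        simp only [hB, Finset.mem_filter, Finset.mem_range]
        exact ⟨by omega, hv.symm⟩
    calc (G q).degree (y (m - 1)) = ((G q).neighborFinset (y (m - 1))).card := rfl
      _ ≤ _ := Finset.card_le_card hsub
      _ ≤ _ := Finset.card_union_le _ _
      _ ≤ _ := by gcongr; exact Finset.card_image_le
  have hdisj : Disjoint A B := by
    rw [Finset.disjoint_left]
    intro t ha hb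
    simp only [hA, hB, Finset.mem_filter, Finset.mem_range] at ha hb
    exact hn2 t ha.1 ha.2 hb.2
  have hAB : A ∪ B ⊆ Finset.range (m - 1) :=
    Finset.union_subset (Finset.filter_subset _ _) (Finset.filter_subset _ _)
  have hcard := Finset.card_union_of_disjoint hdisj
  have hle := Finset.card_le_card hAB
  rw [Finset.card_range] at hle
  have hWp1 : Wp.card ≤ 1 := by rw [hWp]; split_ifs <;> simp
  have hWq1 : Wq.card ≤ 1 := by rw [hWq]; split_ifs <;> simp
  refine ⟨hn1, ?_, ?_, ?_, hn2⟩
  · by_contra h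
    have : Wp.card = 0 := by simp [hWp, h]
    omega
  · by_contra h
    have : Wq.card = 0 := by simp [hWq, h]
    omega
  · intro t ht
    have heq : A ∪ B = Finset.range (m - 1) :=
      Finset.eq_of_subset_of_card_le hAB (by rw [Finset.card_range]; omega)
    have : t ∈ A ∪ B := by rw [heq]; simpa using ht
    rw [Finset.mem_union] at this
    simp only [hA, hB, Finset.mem_filter, Finset.mem_range] at this
    rcases this with h | h
    · exact Or.inl h.2
    · exact Or.inr h.2

/-- The path lemma applied to a rainbow Hamiltonian cycle with one vertex removed. -/
theorem cycLemma {V : Type*} [Fintype V] {n : ℕ} (hn : 3 ≤ n)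
    (G : ZMod n → SimpleGraph V) [∀ i, DecidableRel (G i).Adj]
    (hσ : ∀ u v : V, u ≠ v → (∃ i, ¬ (G i).Adj u v) →
      ∀ p q, n ≤ (G p).degree u + (G q).degree v)
    (c : ZMod n → V) (hc : Function.Bijective c)
    (π : Equiv.Perm (ZMod n))
    (hπ : ∀ i : ZMod n, (G (π i)).Adj (c i) (c (i + 1)))
    (hno : ¬ HasRainbowCycleThrough G (n - 1) (c 0))
    (k : ZMod n) (hk : k ≠ 0) (p q : ZMod n)
    (hpq : (p = π (k - 1) ∧ q = π k) ∨ (p = π k ∧ q = π (k - 1))) :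
    ¬ (G p).Adj (c (k + 1)) (c (k - 1)) ∧ (G p).Adj (c (k + 1)) (c k) ∧
    (G q).Adj (c (k - 1)) (c k) ∧
    (∀ t : ℕ, t < n - 2 → (G p).Adj (c (k + 1)) (c (k + 2 + t)) ∨
      (G q).Adj (c (k + 1 + t)) (c (k - 1))) ∧
    (∀ t : ℕ, t < n - 2 → (G p).Adj (c (k + 1)) (c (k + 2 + t)) →
      (G q).Adj (c (k + 1 + t)) (c (k - 1)) → False) := by
  have : NeZero n := ⟨by omega⟩
  have : Fact (1 < n) := ⟨by omega⟩
  have hcast : ∀ a b : ℕ, a < n → b < n → (a : ZMod n) = b → a = b := by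
    intro a b ha hb h
    have := congrArg ZMod.val h
    rwa [ZMod.val_cast_of_lt ha, ZMod.val_cast_of_lt hb] at this
  have hn1 : ((n - 1 : ℕ) : ZMod n) = -1 := by
    rw [Nat.cast_sub (by omega)]; simp
  have hn2 : ((n - 2 : ℕ) : ZMod n) = -2 := by
    rw [Nat.cast_sub (by omega)]; simp
  have hne : ∀ a : ℕ, a < n - 2 → k + 1 + (a : ZMod n) ≠ k - 1 ∧ k + 1 + (a : ZMod n) ≠ k := by
    intro a ha
    constructor
    · intro h
      have : (a : ZMod n) = ((n - 2 : ℕ) : ZMod n) := by rw [hn2]; linear_combination h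
      have := hcast _ _ (by omega) (by omega) this
      omega
    · intro h
      have : (a : ZMod n) = ((n - 1 : ℕ) : ZMod n) := by rw [hn1]; linear_combination h
      have := hcast _ _ (by omega) (by omega) this
      omega
  have hcov : ∀ v, v = c k ∨ ∃ s : ℕ, s < n - 1 ∧ c (k + 1 + s) = v := by
    intro v
    obtain ⟨i, rfl⟩ := hc.2 v
    by_cases h : (i - k - 1).val < n - 1
    · right
      refine ⟨_, h, ?_⟩
      rw [ZMod.natCast_zmod_val]
      congr 1; ring
    · left
      have h1 := ZMod.val_lt (i - k - 1)
      have h2 : (i - k - 1).val = n - 1 := by omega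
      have h3 := congrArg (fun t : ℕ => (t : ZMod n)) h2
      simp only [ZMod.natCast_zmod_val, hn1] at h3
      congr 1; linear_combination h3
  have key := pathLemma G (n - 1) (by omega) (by rwa [show n - 1 + 1 = n by omega])
    (fun t => c (k + 1 + t)) (fun t => π (k + 1 + t)) (c 0) (c k) p q
    (by
      have h10 : k - 1 ≠ k := by simp
      rcases hpq with ⟨rfl, rfl⟩ | ⟨rfl, rfl⟩
      · exact fun h => h10 (π.injective h)
      · exact fun h => h10 (π.injective h).symm)
    (by
      intro a b ha hb h
      exact hcast _ _ (by omega) (by omega) (add_left_cancel (hc.1 h)))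
    hcov
    (by
      intro a b ha hb h
      exact hcast _ _ (by omega) (by omega) (add_left_cancel (π.injective h)))
    (by
      intro a ha h
      rcases hpq with ⟨rfl, rfl⟩ | ⟨rfl, rfl⟩
      · exact (hne a (by omega)).1 (π.injective h)
      · exact (hne a (by omega)).2 (π.injective h))
    (by
      intro a ha h
      rcases hpq with ⟨rfl, rfl⟩ | ⟨rfl, rfl⟩
      · exact (hne a (by omega)).2 (π.injective h)
      · exact (hne a (by omega)).1 (π.injective h))
    (by
      intro t ht
      have := hπ (k + 1 + t)
      simpa [add_assoc] using this)
    (by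
      rcases hcov (c 0) with h | h
      · exact absurd (hc.1 h).symm hk
      · exact h)
    hno
  have e1 : ∀ t : ℕ, k + 1 + ((t + 1 : ℕ) : ZMod n) = k + 2 + t := by
    intro t; push_cast; ring
  have e2 : k + 1 + ((n - 1 - 1 : ℕ) : ZMod n) = k - 1 := by
    rw [show n - 1 - 1 = n - 2 by omega, hn2]; ring
  simp only [e1, e2, Nat.cast_zero, add_zero] at key
  rw [show n - 1 - 1 = n - 2 by omega] at key
  exact key

theorem allGood {V : Type*} [Fintype V] {n : ℕ} (hn : 3 ≤ n)
    (G : ZMod n → SimpleGraph V) [∀ i, DecidableRel (G i).Adj]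
    (hσ : ∀ u v : V, u ≠ v → (∃ i, ¬ (G i).Adj u v) →
      ∀ p q, n ≤ (G p).degree u + (G q).degree v)
    (c : ZMod n → V) (hc : Function.Bijective c)
    (π : Equiv.Perm (ZMod n))
    (hπ : ∀ i : ZMod n, (G (π i)).Adj (c i) (c (i + 1)))
    (hno : ¬ HasRainbowCycleThrough G (n - 1) (c 0)) :
    ∀ τ : Equiv.Perm (ZMod n), ∀ i, (G ((π * τ) i)).Adj (c i) (c (i + 1)) := by
  obtain ⟨N, rfl⟩ : ∃ N, n = N + 1 := ⟨n - 1, by omega⟩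
  have : Fact (1 < N + 1) := ⟨by omega⟩
  have step : ∀ (ρ : Equiv.Perm (ZMod (N + 1))) (k : ZMod (N + 1)), k ≠ 0 →
      (∀ i, (G (ρ i)).Adj (c i) (c (i + 1))) →
      ∀ i, (G ((ρ * Equiv.swap (k - 1) k) i)).Adj (c i) (c (i + 1)) := by
    intro ρ k hk hρ i
    obtain ⟨-, h1, h2, -⟩ := cycLemma hn G hσ c hc ρ hρ hno k hk _ _ (Or.inl ⟨rfl, rfl⟩)
    rw [Equiv.Perm.mul_apply]
    by_cases hi : i = k - 1
    · subst hi
      rw [Equiv.swap_apply_left]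
      simpa using h2
    · by_cases hi' : i = k
      · subst hi'
        rw [Equiv.swap_apply_right]
        exact h1.symm
      · rw [Equiv.swap_apply_of_ne_of_ne hi hi']
        exact hρ i
  intro τ
  have hτ : τ ∈ Submonoid.closure (Set.range fun i : Fin N =>
      (Equiv.swap (i.castSucc) (i.succ) : Equiv.Perm (Fin (N + 1)))) := by
    rw [Equiv.Perm.mclosure_swap_castSucc_succ]; trivial
  induction hτ using Submonoid.closure_induction_right with
  | one => simpa using hπ
  | mul_right x hx y hy ih =>
    obtain ⟨i, rfl⟩ := hy
    have hs : (i.castSucc : Fin (N + 1)) = i.succ - 1 := by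
      rw [← Fin.coeSucc_eq_succ]; exact (add_sub_cancel_right (G := ZMod (N + 1)) _ 1).symm
    have := step (π * x) (i.succ : Fin (N + 1)) (Fin.succ_ne_zero i) ih
    simp only [hs]
    exact this

theorem stmt0 {V : Type*} [Fintype V] {n : ℕ} (hn : 3 ≤ n)
    (G : ZMod n → SimpleGraph V) [∀ i, DecidableRel (G i).Adj]
    (hσ : ∀ u v : V, u ≠ v → (∃ i, ¬ (G i).Adj u v) →
      ∀ p q, n ≤ (G p).degree u + (G q).degree v)
    (c : ZMod n → V) (hc : Function.Bijective c)
    (π : Equiv.Perm (ZMod n))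
    (hπ : ∀ i : ZMod n, (G (π i)).Adj (c i) (c (i + 1)))
    (hno : ¬ HasRainbowCycleThrough G (n - 1) (c 0)) :
    ∀ k j : ZMod n, ¬ (G j).Adj (c (k + 1)) (c (k - 1)) := by
  have : NeZero n := ⟨by omega⟩
  have : Fact (1 < n) := ⟨by omega⟩
  have all : ∀ ρ : Equiv.Perm (ZMod n), ∀ i, (G (ρ i)).Adj (c i) (c (i + 1)) := by
    intro ρ i
    have := allGood hn G hσ c hc π hπ hno (π⁻¹ * ρ) i
    simpa using this
  have L : ∀ k : ZMod n, k ≠ 0 → ∀ p q, p ≠ q →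
      ¬ (G p).Adj (c (k + 1)) (c (k - 1)) ∧
      (∀ t : ℕ, t < n - 2 → (G p).Adj (c (k + 1)) (c (k + 2 + t)) ∨
        (G q).Adj (c (k + 1 + t)) (c (k - 1))) ∧
      (∀ t : ℕ, t < n - 2 → (G p).Adj (c (k + 1)) (c (k + 2 + t)) →
        (G q).Adj (c (k + 1 + t)) (c (k - 1)) → False) := by
    intro k hk p q hpq
    obtain ⟨ρ, h1, h2⟩ : ∃ ρ : Equiv.Perm (ZMod n), ρ (k - 1) = p ∧ ρ k = q := by
      have h10 : k - 1 ≠ k := by simp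
      refine ⟨Equiv.swap (Equiv.swap (k - 1) p k) q * Equiv.swap (k - 1) p, ?_, ?_⟩
      · rw [Equiv.Perm.mul_apply, Equiv.swap_apply_left, Equiv.swap_apply_of_ne_of_ne _ hpq]
        intro h
        have := congrArg (Equiv.swap (k - 1) p) h
        simp at this
      · simp
    obtain ⟨a, -, -, b, d⟩ := cycLemma hn G hσ c hc ρ (all ρ) hno k hk p q
      (Or.inl ⟨h1.symm, h2.symm⟩)
    exact ⟨a, b, d⟩
  have skip : ∀ k j : ZMod n, k ≠ 0 → ¬ (G j).Adj (c (k + 1)) (c (k - 1)) :=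
    fun k j hk => (L k hk j (j + 1) (by simp)).1
  intro k j
  by_cases hk : k ≠ 0
  · exact skip k j hk
  push Not at hk
  subst hk
  intro hadj
  rcases (by omega : n = 3 ∨ 4 ≤ n) with rfl | h4
  · rcases (L 1 one_ne_zero 0 1 (by decide)).2.1 0 (by omega) with h | h
    · apply skip 1 0 one_ne_zero
      convert h using 2
      decide
    · apply skip 1 1 one_ne_zero
      convert h using 2
      simp
  · have hcz : ∀ a : ℕ, 0 < a → a < n → (-(a : ZMod n)) ≠ 0 := by
      intro a h0 ha h
      rw [neg_eq_zero, ZMod.natCast_eq_zero_iff] at h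
      exact absurd (Nat.le_of_dvd h0 h) (by omega)
    have k1 : (-1 : ZMod n) ≠ 0 := by simpa using hcz 1 (by omega) (by omega)
    have k2 : (-2 : ZMod n) ≠ 0 := by simpa using hcz 2 (by omega) (by omega)
    have k3 : (-3 : ZMod n) ≠ 0 := by simpa using hcz 3 (by omega) (by omega)
    have hn4 : ((n - 4 : ℕ) : ZMod n) = -4 := by
      rw [Nat.cast_sub (by omega)]; simp
    have hbig : (G (j + 1)).Adj (c 0) (c (-3)) := by
      rcases (L (-1) k1 (j + 1) j (by simp)).2.1 (n - 4) (by omega) with h | h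
      · rw [hn4] at h
        convert h using 2 <;> ring
      · exfalso
        rw [hn4] at h
        apply skip (-3) j k3
        convert h.symm using 2 <;> ring
    refine (L (-2) k2 j (j + 1) (by simp)).2.2 1 (by omega) ?_ ?_
    · convert hadj.symm using 2 <;> push_cast <;> ring
    · convert hbig using 2 <;> push_cast <;> ring

theorem stmt6 {V : Type*} [Fintype V] {n : ℕ} (hn : 3 ≤ n)
    (hV : Fintype.card V = n)
    (G : ZMod n → SimpleGraph V) [∀ i, DecidableRel (G i).Adj]
    (hσ : ∀ u v : V, u ≠ v → (∃ i, ¬ (G i).Adj u v) →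
      ∀ p q, n ≤ (G p).degree u + (G q).degree v)
    (c : ZMod n → V) (hc : Function.Bijective c)
    (hCn : ∀ i : ZMod n, (G i).Adj (c i) (c (i + 1)))
    (hno : ¬ HasRainbowCycleThrough G (n - 1) (c 1)) :
    ∀ i j : ZMod n, ¬ (G j).Adj (c i) (c (i + 2)) := by
  intro i j h
  refine stmt0 hn G hσ (fun t => c (t + 1)) (hc.comp (Equiv.addRight (1 : ZMod n)).bijective)
    (Equiv.addRight (1 : ZMod n)) (fun t => hCn (t + 1)) (by simpa using hno) i j ?_
  convert h.symm using 2 <;> ring
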